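/- Let G be a connected finite simple graph of order n with at least one edge and maximum degree Δ(G) ≥ (n − 2)/3. Then es_Δ(G) ≤ ⌈n/2⌉. -/

import Mathlib

open SimpleGraph

attribute [local instance] Classical.propDecidable

universe u

variable {V : Type u}

/-- A set of edges of `G` is *mitigating* if its removal decreases the maximum degree
of `G` by exactly one. -/
def SimpleGraph.IsMitigating [Fintype V] (G : SimpleGraph V) (S : Set (Sym2 V)) : Prop :=
  S ⊆ G.edgeSet ∧ (G.deleteEdges S).maxDegree = G.maxDegree - 1

/-- The Δ-edge stability number `es_Δ(G)`: the minimum cardinality of a mitigating set. -/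
noncomputable def SimpleGraph.esDelta [Fintype V] (G : SimpleGraph V) : ℕ :=
  sInf {n | ∃ S : Set (Sym2 V), G.IsMitigating S ∧ S.ncard = n}

namespace SimpleGraph

/-- A set of edges meeting every vertex of maximum degree contains a mitigating set. -/
lemma esDelta_le_card_of_cover [Fintype V] (G : SimpleGraph V) (hE : G.edgeSet.Nonempty)
    (S : Finset (Sym2 V)) (hS : ∀ e ∈ S, e ∈ G.edgeSet)
    (hcov : ∀ v, G.degree v = G.maxDegree → ∃ e ∈ S, v ∈ e) : G.esDelta ≤ S.card := by
  induction S using Finset.strongInduction with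
  | H S ih =>
  by_cases hmin : ∃ e ∈ S, ∀ v, G.degree v = G.maxDegree → ∃ f ∈ S.erase e, v ∈ f
  · obtain ⟨e, he, hcov'⟩ := hmin
    exact (ih _ (Finset.erase_ssubset he) (fun f hf => hS f (Finset.mem_of_mem_erase hf))
      hcov').trans (Finset.card_le_card (Finset.erase_subset _ _))
  push Not at hmin
  obtain ⟨T, hT⟩ : ∃ T : Set (Sym2 V), T = S := ⟨_, rfl⟩
  have hTS : ∀ e, e ∈ T ↔ e ∈ S := fun e => by rw [hT, Finset.mem_coe]
  refine Nat.sInf_le ⟨T, ⟨fun e he => hS e ((hTS e).mp he), ?_⟩, hT ▸ Set.ncard_coe_finset S⟩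
  have hsub : ∀ v, (G.deleteEdges T).neighborFinset v ⊆ G.neighborFinset v := by
    intro v w
    simp only [mem_neighborFinset, deleteEdges_adj]
    exact And.left
  have : Nonempty V := by
    obtain ⟨e, he⟩ := hE
    induction e with | _ a b => exact ⟨a⟩
  have hlt : ∀ v, (G.deleteEdges T).degree v ≤ G.maxDegree - 1 := by
    intro v
    by_cases hv : G.degree v = G.maxDegree
    · obtain ⟨e, he, hve⟩ := hcov v hv
      obtain ⟨w, rfl⟩ := Sym2.mem_iff_exists.mp hve
      have hss : (G.deleteEdges T).neighborFinset v ⊂ G.neighborFinset v := by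
        refine Finset.ssubset_iff_subset_ne.mpr ⟨hsub v, fun h => ?_⟩
        have hw : w ∈ G.neighborFinset v := by simpa using hS _ he
        rw [← h, mem_neighborFinset, deleteEdges_adj] at hw
        exact hw.2 ((hTS _).mpr he)
      have := Finset.card_lt_card hss
      rw [card_neighborFinset_eq_degree, card_neighborFinset_eq_degree] at this
      omega
    · have h1 := Finset.card_le_card (hsub v)
      rw [card_neighborFinset_eq_degree, card_neighborFinset_eq_degree] at h1
      have := G.degree_le_maxDegree v
      omega
  refine le_antisymm (maxDegree_le_of_forall_degree_le _ _ hlt) ?_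
  obtain ⟨v₀, hv₀⟩ := G.exists_maximal_degree_vertex
  obtain ⟨e, he, -⟩ := hcov v₀ hv₀.symm
  obtain ⟨v, hv, hunc⟩ := hmin e he
  have hins : (G.neighborFinset v).card ≤
      ((G.deleteEdges T).neighborFinset v).card + 1 := by
    obtain ⟨f, hf, hvf⟩ := hcov v hv
    obtain ⟨w, rfl⟩ := Sym2.mem_iff_exists.mp hvf
    refine (Finset.card_le_card (t := insert w
      ((G.deleteEdges T).neighborFinset v)) fun u hu => ?_).trans
      (Finset.card_insert_le _ _)
    rw [mem_neighborFinset] at hu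
    rw [Finset.mem_insert, mem_neighborFinset, deleteEdges_adj]
    by_cases hs : s(v, u) ∈ S
    · left
      have h1 : s(v, u) = e := by
        by_contra h
        exact hunc _ (Finset.mem_erase.mpr ⟨h, hs⟩) (Sym2.mem_mk_left _ _)
      have h2 : s(v, w) = e := by
        by_contra h
        exact hunc _ (Finset.mem_erase.mpr ⟨h, hf⟩) (Sym2.mem_mk_left _ _)
      exact Sym2.congr_right.mp (h1.trans h2.symm)
    · exact Or.inr ⟨hu, fun h => hs ((hTS _).mp h)⟩
  rw [card_neighborFinset_eq_degree, card_neighborFinset_eq_degree, hv] at hins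
  have := (G.deleteEdges T).degree_le_maxDegree v
  omega

/-- If deleting `B` from a connected graph leaves at least `|B| + 2` disjoint pieces consisting of
vertices of maximum degree `Δ`, then the graph has at least `3 (Δ + 1)` vertices. -/
lemma three_mul_succ_maxDegree_le_card [Fintype V] (G : SimpleGraph V) (hconn : G.Connected)
    {ι : Type*} [Fintype ι] (B : Finset V) (C : ι → Finset V) (hne : ∀ i, (C i).Nonempty)
    (hdisj : ∀ i j, i ≠ j → Disjoint (C i) (C j))
    (hdeg : ∀ i, ∀ v ∈ C i, G.degree v = G.maxDegree)
    (hnb : ∀ i v w, v ∈ C i → G.Adj v w → w ∈ C i ∨ w ∈ B)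
    (hcard : B.card + 2 ≤ Fintype.card ι) : 3 * (G.maxDegree + 1) ≤ Fintype.card V := by
  set D := G.maxDegree
  let e : ι → ℕ := fun i => ∑ v ∈ C i, (G.neighborFinset v ∩ B).card
  have hsmall : ∀ i, (C i).card ≤ D → D ≤ e i := by
    intro i hi
    have hpos := (hne i).card_pos
    have h1 : ∀ v ∈ C i, D + 1 - (C i).card ≤ (G.neighborFinset v ∩ B).card := by
      intro v hv
      have hsub : G.neighborFinset v ⊆ (C i).erase v ∪ (G.neighborFinset v ∩ B) := by
        intro w hw
        have hadj := (G.mem_neighborFinset v w).mp hw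
        rcases hnb i v w hv hadj with h | h
        · exact Finset.mem_union_left _ (Finset.mem_erase.mpr ⟨hadj.ne', h⟩)
        · exact Finset.mem_union_right _ (Finset.mem_inter.mpr ⟨hw, h⟩)
      have h2 := (Finset.card_le_card hsub).trans (Finset.card_union_le _ _)
      rw [card_neighborFinset_eq_degree, hdeg i v hv, Finset.card_erase_of_mem hv] at h2
      omega
    have h2 := Finset.card_nsmul_le_sum _ _ _ h1
    refine le_trans ?_ h2
    obtain ⟨s, hs⟩ := Nat.exists_eq_add_of_le' hpos
    obtain ⟨t, ht⟩ := Nat.exists_eq_add_of_le hi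
    rw [smul_eq_mul, show D + 1 - (C i).card = t + 1 by omega, ht, hs]
    nlinarith [Nat.zero_le (s * t)]
  have hone : ∀ i, 1 ≤ e i := by
    intro i
    have : Nontrivial ι := Fintype.one_lt_card_iff_nontrivial.mp (by omega)
    obtain ⟨j, hj⟩ := exists_ne i
    obtain ⟨a, ha⟩ := hne i
    obtain ⟨b, hb⟩ := hne j
    obtain ⟨p⟩ := hconn.preconnected a b
    obtain ⟨d, -, hd1, hd2⟩ := p.exists_boundary_dart (C i : Set V) ha
      (Finset.disjoint_left.mp (hdisj j i hj) hb)
    have hdB := (hnb i d.fst d.snd hd1 d.adj).resolve_left hd2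
    have hpos : 0 < (G.neighborFinset d.fst ∩ B).card :=
      Finset.card_pos.mpr ⟨d.snd, Finset.mem_inter.mpr ⟨by simp, hdB⟩⟩
    exact Nat.succ_le_of_lt (hpos.trans_le
      (Finset.single_le_sum (f := fun v => (G.neighborFinset v ∩ B).card)
        (fun _ _ => Nat.zero_le _) hd1))
  have hpd : Set.PairwiseDisjoint (Finset.univ : Finset ι) C := fun i _ j _ hij => hdisj i j hij
  have htotal : ∑ i, e i ≤ B.card * D := by
    calc ∑ i, e i = ∑ v ∈ Finset.univ.biUnion C, (G.neighborFinset v ∩ B).card :=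
          (Finset.sum_biUnion hpd).symm
      _ ≤ ∑ v, (G.neighborFinset v ∩ B).card :=
          Finset.sum_le_sum_of_subset (Finset.subset_univ _)
      _ = ∑ v, ∑ b ∈ B, if G.Adj v b then 1 else 0 := by
          refine Finset.sum_congr rfl fun v _ => ?_
          rw [← Finset.card_filter]
          congr 1
          ext w
          simp [and_comm]
      _ = ∑ b ∈ B, ∑ v, if G.Adj v b then 1 else 0 := Finset.sum_comm
      _ = ∑ b ∈ B, G.degree b := by
          refine Finset.sum_congr rfl fun b _ => ?_
          rw [← Finset.card_filter, ← card_neighborFinset_eq_degree]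
          congr 1
          ext w
          simp [adj_comm]
      _ ≤ B.card * D := Finset.sum_le_card_nsmul _ _ _ fun b _ => G.degree_le_maxDegree b
  let P : Finset ι := Finset.univ.filter fun i => D + 1 ≤ (C i).card
  let Q : Finset ι := Finset.univ.filter fun i => ¬ D + 1 ≤ (C i).card
  have hPQ : P.card + Q.card = Fintype.card ι :=
    Finset.card_filter_add_card_filter_not _
  have hbig : P.card * (D + 1) ≤ Fintype.card V := by
    calc P.card * (D + 1) ≤ ∑ i ∈ P, (C i).card :=
          Finset.card_nsmul_le_sum P (fun i => (C i).card) (D + 1) fun i hi =>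
            (Finset.mem_filter.mp hi).2
      _ ≤ ∑ i, (C i).card := Finset.sum_le_sum_of_subset (Finset.subset_univ _)
      _ = (Finset.univ.biUnion C).card := (Finset.card_biUnion fun i _ j _ => hdisj i j).symm
      _ ≤ Fintype.card V := Finset.card_le_univ _
  have hlower : P.card + Q.card * D ≤ ∑ i, e i := by
    rw [← Finset.sum_filter_add_sum_filter_not Finset.univ (fun i => D + 1 ≤ (C i).card)]
    refine Nat.add_le_add ?_ ?_
    · exact (mul_one P.card).ge.trans (Finset.card_nsmul_le_sum P e 1 fun i _ => hone i)
    · exact Finset.card_nsmul_le_sum Q e D fun i hi => hsmall i (by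
        have := (Finset.mem_filter.mp hi).2
        omega)
  have hιe : Fintype.card ι ≤ ∑ i, e i := by
    simpa using Finset.card_nsmul_le_sum Finset.univ e 1 fun i _ => hone i
  have hDpos : 0 < D := by
    by_contra h
    have : D = 0 := by omega
    rw [this] at htotal
    omega
  have hP : 3 ≤ P.card := by
    by_contra hP
    have hQB : B.card * D ≤ Q.card * D := Nat.mul_le_mul_right _ (by omega)
    have hP0 : P.card = 0 := by omega
    have : (B.card + 2) * D ≤ Q.card * D := Nat.mul_le_mul_right _ (by omega)
    nlinarith
  exact (Nat.mul_le_mul_right _ hP).trans hbig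

/-- A Tutte violator in a graph of even order leaves at least two more odd components than it has
vertices. -/
lemma IsTutteViolator.ncard_add_two_le {W : Type*} [Fintype W] {F : SimpleGraph W}
    (heven : Even (Fintype.card W)) {U : Set W} (hU : F.IsTutteViolator U) :
    U.ncard + 2 ≤ ((⊤ : F.Subgraph).deleteVerts U).coe.oddComponents.ncard := by
  have hpar := odd_ncard_oddComponents ((⊤ : F.Subgraph).deleteVerts U).coe
  have hsum := Set.ncard_add_ncard_compl U
  have hc : Nat.card ((⊤ : F.Subgraph).deleteVerts U).verts = Uᶜ.ncard := by
    rw [Nat.card_coe_set_eq, Subgraph.deleteVerts_verts, Subgraph.verts_top,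
      Set.compl_eq_univ_sdiff]
  rw [hc] at hpar
  rw [Nat.card_eq_fintype_card] at hsum
  unfold IsTutteViolator at hU
  rw [Nat.odd_iff, Nat.odd_iff] at hpar
  rw [Nat.even_iff] at heven
  omega

/-- The graph obtained from `G` by adding `k` new vertices and making every vertex outside `H`, old
or new, adjacent to all other vertices. -/
def universalExtension (G : SimpleGraph V) (H : Set V) (k : ℕ) : SimpleGraph (V ⊕ Fin k) where
  Adj x y := x ≠ y ∧ ∀ a ∈ H, ∀ b ∈ H, x = Sum.inl a → y = Sum.inl b → G.Adj a b
  symm := ⟨fun _ _ h => ⟨h.1.symm, fun a ha b hb hy hx => (h.2 b hb a ha hx hy).symm⟩⟩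
  loopless := ⟨fun _ h => h.1 rfl⟩

lemma IsTutteViolator.exists_mem_eq_inl {G : SimpleGraph V} [Fintype V] {H : Set V} {k : ℕ}
    {U : Set (V ⊕ Fin k)} (heven : Even (Fintype.card (V ⊕ Fin k)))
    (hU : (G.universalExtension H k).IsTutteViolator U) {x : V ⊕ Fin k} (hx : x ∉ U) :
    ∃ a ∈ H, x = Sum.inl a := by
  by_contra hxH
  push Not at hxH
  have h2 := hU.ncard_add_two_le heven
  set K := ((⊤ : (G.universalExtension H k).Subgraph).deleteVerts U).coe
  let x' : ((⊤ : (G.universalExtension H k).Subgraph).deleteVerts U).verts := ⟨x, by simp [hx]⟩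
  have hall : ∀ c : K.ConnectedComponent, c = K.connectedComponentMk x' := by
    intro c
    induction c using ConnectedComponent.ind with | _ y =>
    refine ConnectedComponent.sound ?_
    by_cases hyx : y = x'
    · rw [hyx]
    · refine Adj.reachable ?_
      rw [Subgraph.coe_adj, Subgraph.deleteVerts_adj]
      refine ⟨trivial, y.2.2, trivial, hx, fun h => hyx (Subtype.ext h), ?_⟩
      intro a _ b hb _ hxb
      exact absurd hxb (hxH b hb)
  have hle : K.oddComponents.ncard ≤ 1 :=
    Set.ncard_le_one_iff_subsingleton.mpr fun _ _ _ _ => (hall _).trans (hall _).symm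
  omega

lemma exists_isPerfectMatching_universalExtension [Fintype V] (G : SimpleGraph V)
    (hconn : G.Connected) (hcard : Fintype.card V < 3 * (G.maxDegree + 1)) {k : ℕ}
    (heven : Even (Fintype.card (V ⊕ Fin k))) :
    ∃ M : (G.universalExtension {v | G.degree v = G.maxDegree} k).Subgraph,
      M.IsPerfectMatching := by
  rw [tutte]
  intro U hU
  have h2 := hU.ncard_add_two_le heven
  have hmem : ∀ x ∉ U, ∃ a ∈ {v | G.degree v = G.maxDegree}, x = Sum.inl a :=
    fun x hx => hU.exists_mem_eq_inl heven hx
  set T := (⊤ : (G.universalExtension {v | G.degree v = G.maxDegree} k).Subgraph).deleteVerts U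
  let B : Finset V := Finset.univ.filter fun v => Sum.inl v ∈ U
  let C : T.coe.oddComponents → Finset V := fun c =>
    Finset.univ.filter fun v => ∃ h : Sum.inl v ∈ T.verts, (⟨Sum.inl v, h⟩ : T.verts) ∈ c.1.supp
  have hC : ∀ c v, v ∈ C c ↔
      ∃ h : Sum.inl v ∈ T.verts, (⟨Sum.inl v, h⟩ : T.verts) ∈ c.1.supp := by
    intro c v
    simp [C]
  have hdeg : ∀ v, Sum.inl v ∉ U → G.degree v = G.maxDegree := by
    intro v hv
    obtain ⟨a, ha, hva⟩ := hmem _ hv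
    rwa [Sum.inl_injective hva]
  have hBU : B.card ≤ U.ncard := by
    rw [← Set.ncard_coe_finset, ← Set.ncard_image_of_injective _ (Sum.inl_injective (β := Fin k))]
    refine Set.ncard_le_ncard ?_ (Set.toFinite _)
    rintro _ ⟨v, hv, rfl⟩
    simpa [B] using hv
  refine hcard.not_ge (G.three_mul_succ_maxDegree_le_card hconn B C ?_ ?_ ?_ ?_ ?_)
  · rintro ⟨c, hc⟩
    obtain ⟨⟨x, hx⟩, hxc⟩ := c.nonempty_supp
    obtain ⟨a, -, rfl⟩ := hmem x hx.2
    exact ⟨a, (hC _ _).mpr ⟨hx, hxc⟩⟩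
  · intro c d hcd
    refine Finset.disjoint_left.mpr fun v hvc hvd => hcd (Subtype.ext ?_)
    obtain ⟨_, h1⟩ := (hC _ _).mp hvc
    obtain ⟨_, h2⟩ := (hC _ _).mp hvd
    exact ConnectedComponent.eq_of_common_vertex h1 h2
  · intro c v hv
    obtain ⟨h, -⟩ := (hC _ _).mp hv
    exact hdeg v h.2
  · intro c v w hv hvw
    obtain ⟨h, hvc⟩ := (hC _ _).mp hv
    by_cases hw : Sum.inl w ∈ U
    · exact Or.inr (by simpa [B] using hw)
    · refine Or.inl ((hC _ _).mpr ⟨⟨trivial, hw⟩, c.1.mem_supp_of_adj_mem_supp hvc ?_⟩)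
      rw [Subgraph.coe_adj, Subgraph.deleteVerts_adj]
      refine ⟨trivial, h.2, trivial, hw, fun h' => hvw.ne (Sum.inl_injective h'), ?_⟩
      intro a _ b _ ha hb
      rwa [← Sum.inl_injective ha, ← Sum.inl_injective hb]
  · rw [← Nat.card_eq_fintype_card, Nat.card_coe_set_eq]
    omega

lemma Subgraph.IsPerfectMatching.two_mul_ncard_edgeSet {W : Type*} [Fintype W]
    {F : SimpleGraph W} {M : F.Subgraph} (hM : M.IsPerfectMatching) :
    2 * M.edgeSet.ncard = Fintype.card W := by
  have h := M.spanningCoe.sum_degrees_eq_twice_card_edges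
  have hd : ∀ v, M.spanningCoe.degree v = 1 := fun v => by
    rw [Subgraph.degree_spanningCoe]
    exact Subgraph.isPerfectMatching_iff_forall_degree.mp hM v
  simp only [hd, Finset.sum_const, Finset.card_univ, smul_eq_mul, mul_one] at h
  rw [h, ← Subgraph.edgeSet_spanningCoe, ← Set.ncard_coe_finset, coe_edgeFinset]

end SimpleGraph

/-- For a connected graph of order `n` with at least one edge and maximum degree
`Δ(G) ≥ (n−2)/3`, we have `es_Δ(G) ≤ ⌈n/2⌉`. -/
theorem stmt_19 [Fintype V] (G : SimpleGraph V) (hE : G.edgeSet.Nonempty)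
    (hconn : G.Connected)
    (hdeg : ((Fintype.card V : ℝ) - 2) / 3 ≤ (G.maxDegree : ℝ)) :
    G.esDelta ≤ (Fintype.card V + 1) / 2 := by
  have hcard : Fintype.card V < 3 * (G.maxDegree + 1) := by
    have : (Fintype.card V : ℝ) < 3 * (G.maxDegree + 1) := by linarith
    exact_mod_cast this
  have hW : Fintype.card (V ⊕ Fin (Fintype.card V % 2)) =
      Fintype.card V + Fintype.card V % 2 := by simp
  obtain ⟨M, hM⟩ := G.exists_isPerfectMatching_universalExtension hconn hcard
    (k := Fintype.card V % 2) (by rw [hW, Nat.even_iff]; omega)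
  obtain ⟨e₀, he₀⟩ := hE
  have hinc : ∀ v, G.degree v = G.maxDegree → ∃ w, G.Adj v w := by
    intro v hv
    have : Nontrivial V := by
      induction e₀ with | _ a b => exact ⟨a, b, G.ne_of_adj he₀⟩
    exact hconn.preconnected.exists_adj_of_nontrivial v
  have hedge : ∀ e ∈ M.edgeSet, ∃ f ∈ G.edgeSet,
      ∀ v, G.degree v = G.maxDegree → Sum.inl v ∈ e → v ∈ f := by
    intro e he
    induction e with | _ x y =>
    have hadj := M.adj_sub he
    by_cases hx : ∃ a, G.degree a = G.maxDegree ∧ x = Sum.inl a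
    · obtain ⟨a, ha, rfl⟩ := hx
      by_cases hy : ∃ b, G.degree b = G.maxDegree ∧ y = Sum.inl b
      · obtain ⟨b, hb, rfl⟩ := hy
        refine ⟨s(a, b), hadj.2 a ha b hb rfl rfl, fun v _ hv => ?_⟩
        simpa using hv
      · obtain ⟨w, hw⟩ := hinc a ha
        refine ⟨s(a, w), hw, fun v hv hve => ?_⟩
        rcases Sym2.mem_iff.mp hve with h | h
        · simp [Sum.inl_injective h]
        · exact absurd ⟨v, hv, h.symm⟩ hy
    · by_cases hy : ∃ b, G.degree b = G.maxDegree ∧ y = Sum.inl b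
      · obtain ⟨b, hb, rfl⟩ := hy
        obtain ⟨w, hw⟩ := hinc b hb
        refine ⟨s(b, w), hw, fun v hv hve => ?_⟩
        rcases Sym2.mem_iff.mp hve with h | h
        · exact absurd ⟨v, hv, h.symm⟩ hx
        · simp [Sum.inl_injective h]
      · refine ⟨e₀, he₀, fun v hv hve => ?_⟩
        rcases Sym2.mem_iff.mp hve with h | h
        · exact absurd ⟨v, hv, h.symm⟩ hx
        · exact absurd ⟨v, hv, h.symm⟩ hy
  have : Nonempty (Sym2 V) := ⟨e₀⟩
  choose! φ hφG hφ using hedge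
  let E : Finset (Sym2 (V ⊕ Fin (Fintype.card V % 2))) := M.edgeSet.toFinset
  have hmemE : ∀ e, e ∈ E ↔ e ∈ M.edgeSet := fun e => Set.mem_toFinset
  have hEcard : 2 * E.card = Fintype.card V + Fintype.card V % 2 := by
    rw [← hW, ← hM.two_mul_ncard_edgeSet, Set.ncard_eq_toFinset_card']
  refine (G.esDelta_le_card_of_cover ⟨e₀, he₀⟩ (E.image φ) ?_ ?_).trans
    (Finset.card_image_le.trans (by omega))
  · intro f hf
    obtain ⟨e, he, rfl⟩ := Finset.mem_image.mp hf
    exact hφG e ((hmemE e).mp he)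
  · intro v hv
    obtain ⟨w, hw, -⟩ := Subgraph.isPerfectMatching_iff.mp hM (Sum.inl v)
    have he : s(Sum.inl v, w) ∈ M.edgeSet := hw
    exact ⟨_, Finset.mem_image_of_mem φ ((hmemE _).mpr he), hφ _ he v hv (Sym2.mem_mk_left _ _)⟩
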